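/- Let d ≥ 1 be an integer, s ∈ (0, 1/2), and q₀ > d a real number. Define w : ℝ^d → ℝ by w(x) = (1 + ‖x‖²)^(−q₀/2). Then there exists a constant C > 0 such that for every x ∈ ℝ^d, the integral ∫_{ℝ^d} (w(x) − w(y))/‖x−y‖^(d+2s) dy is absolutely convergent and |∫_{ℝ^d} (w(x) − w(y))/‖x−y‖^(d+2s) dy| ≤ C (1 + ‖x‖²)^(−(d+2s)/2). -/

import Mathlib

open Real MeasureTheory

/-- Radial majorant profile. -/
noncomputable def radG (p t : ℝ) : ℝ := if t ≤ 1 then t ^ (1 - p) else t ^ (-p)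

lemma radG_nonneg (p t : ℝ) (ht : 0 ≤ t) : 0 ≤ radG p t := by
  unfold radG; split_ifs <;> positivity

lemma radG_integrable (d : ℕ) (hd : 1 ≤ d) (s : ℝ) (hs1 : 0 < s) (hs2 : s < 1 / 2) :
    Integrable (fun z : EuclideanSpace ℝ (Fin d) => radG ((d : ℝ) + 2 * s) ‖z‖) := by
  have : Nonempty (Fin d) := ⟨⟨0, hd⟩⟩
  have : Nontrivial (EuclideanSpace ℝ (Fin d)) := by
    apply Module.nontrivial_of_finrank_pos (R := ℝ)
    rw [finrank_euclideanSpace_fin]; omega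
  rw [integrable_fun_norm_addHaar volume (f := radG ((d : ℝ) + 2 * s))]
  rw [finrank_euclideanSpace_fin, ← Set.Ioc_union_Ioi_eq_Ioi (zero_le_one' ℝ)]
  have hc : ((d - 1 : ℕ) : ℝ) = (d : ℝ) - 1 := by push_cast [Nat.cast_sub hd]; rfl
  apply IntegrableOn.union
  · have h : IntegrableOn (fun t : ℝ => t ^ (-(2 * s))) (Set.Ioc 0 1) := by
      rw [← intervalIntegrable_iff_integrableOn_Ioc_of_le zero_le_one]
      exact intervalIntegral.intervalIntegrable_rpow' (by linarith)
    refine h.congr_fun ?_ measurableSet_Ioc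
    intro t ht
    simp only [radG, if_pos ht.2, smul_eq_mul]
    rw [← Real.rpow_natCast, ← Real.rpow_add ht.1, hc]
    congr 1; ring
  · have h : IntegrableOn (fun t : ℝ => t ^ (-1 - 2 * s)) (Set.Ioi 1) :=
      integrableOn_Ioi_rpow_of_lt (by linarith) one_pos
    refine h.congr_fun ?_ measurableSet_Ioi
    intro t ht
    have h1 : (1 : ℝ) < t := ht
    simp only [radG, if_neg (not_le.2 h1), smul_eq_mul]
    rw [← Real.rpow_natCast, ← Real.rpow_add (by linarith), hc]
    congr 1; ring

lemma rpow_mvt (q R a b : ℝ) (hq : 0 < q) (hR : 0 < R) (ha : R ≤ a) (hb : R ≤ b) :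
    |a ^ (-q) - b ^ (-q)| ≤ q * R ^ (-q - 1) * |a - b| := by
  have := (convex_Ici R).norm_image_sub_le_of_norm_hasDerivWithin_le
    (f := fun t : ℝ => t ^ (-q)) (f' := fun t => (-q) * t ^ (-q - 1)) (C := q * R ^ (-q - 1))
    (x := b) (y := a) ?_ ?_ hb ha
  · simpa using this
  · intro t ht
    have ht' : R ≤ t := ht
    exact (Real.hasDerivAt_rpow_const (Or.inl (by linarith))).hasDerivWithinAt
  · intro t ht
    have ht' : R ≤ t := ht
    have h0 : 0 < t := by linarith
    rw [norm_mul, norm_neg, Real.norm_of_nonneg hq.le, Real.norm_of_nonneg (by positivity)]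
    exact mul_le_mul_of_nonneg_left
      (Real.rpow_le_rpow_of_nonpos hR ht' (by linarith)) hq.le

lemma jap_lip (a b : ℝ) : |√(1 + a ^ 2) - √(1 + b ^ 2)| ≤ |a - b| := by
  have key : ∀ a b : ℝ, √(1 + a ^ 2) ≤ √(1 + b ^ 2) + |a - b| := by
    intro a b
    have h1 : |b| ≤ √(1 + b ^ 2) := Real.abs_le_sqrt (by linarith)
    have h2 := Real.sq_sqrt (show 0 ≤ 1 + b ^ 2 by positivity)
    apply Real.sqrt_le_iff.2
    refine ⟨by positivity, ?_⟩
    have h3 : b * (a - b) ≤ √(1 + b ^ 2) * |a - b| :=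
      (le_abs_self _).trans (by rw [abs_mul]; gcongr)
    nlinarith [sq_abs (a - b)]
  rw [abs_le]
  have := key a b
  have h := key b a
  rw [abs_sub_comm] at h
  constructor <;> linarith

lemma scalar_bound (q p J K t : ℝ) (hq : 0 < q) (hp : 0 < p) (hJ : 0 < J) (hK : 0 < K)
    (ht : 0 ≤ t) (hJK : |J - K| ≤ t) :
    |(J ^ (-q) - K ^ (-q)) / t ^ p| ≤
      (q + 1) * (J / 2) ^ (-q) * (J / 2) ^ (-p) * radG p ((J / 2)⁻¹ * t)
        + (J / 2) ^ (-p) * K ^ (-q) := by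
  obtain ⟨R, hR⟩ : ∃ R, R = J / 2 := ⟨_, rfl⟩
  have hR0 : 0 < R := by rw [hR]; positivity
  rw [← hR]
  have hG : 0 ≤ radG p (R⁻¹ * t) := radG_nonneg _ _ (by positivity)
  rcases ht.eq_or_lt with h0 | h0
  · have : J = K := by
      rw [← h0] at hJK
      have := abs_nonpos_iff.1 hJK
      linarith
    rw [this]; simp only [sub_self, zero_div, abs_zero]
    positivity
  have htp : 0 < t ^ p := by positivity
  rw [abs_div, abs_of_pos htp]
  rcases le_or_gt t R with h1 | h1
  · have hKR : R ≤ K := by have := (abs_le.1 hJK).2; linarith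
    have hm := rpow_mvt q R J K hq hR0 (by linarith) hKR
    have hg : radG p (R⁻¹ * t) = R ^ (p - 1) * (t / t ^ p) := by
      rw [radG, if_pos (by rw [inv_mul_le_iff₀ hR0]; linarith),
        Real.mul_rpow (by positivity) h0.le, Real.inv_rpow hR0.le, ← Real.rpow_neg hR0.le,
        Real.rpow_sub h0, Real.rpow_one]
      congr 2; ring
    have h2 : R ^ (-p) * R ^ (p - 1) = R⁻¹ := by
      rw [← Real.rpow_add hR0, ← Real.rpow_neg_one]; congr 1; ring
    have h3 : R ^ (-q - 1) = R ^ (-q) * R⁻¹ := by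
      rw [Real.rpow_sub hR0, Real.rpow_one]; rfl
    calc |J ^ (-q) - K ^ (-q)| / t ^ p ≤ (q * R ^ (-q - 1) * t) / t ^ p := by
          gcongr
          exact hm.trans (by gcongr)
      _ = q * R ^ (-q) * R ^ (-p) * radG p (R⁻¹ * t) := by
          rw [hg, h3, ← h2]; ring
      _ ≤ (q + 1) * R ^ (-q) * R ^ (-p) * radG p (R⁻¹ * t) := by
          gcongr; linarith
      _ ≤ _ := le_add_of_nonneg_right (by positivity)
  · have hg : R ^ (-p) * radG p (R⁻¹ * t) = t ^ (-p) := by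
      rw [radG, if_neg (by rw [inv_mul_le_iff₀ hR0]; linarith),
        ← Real.mul_rpow hR0.le (by positivity), mul_inv_cancel_left₀ hR0.ne']
    have hA : |J ^ (-q) - K ^ (-q)| ≤ R ^ (-q) + K ^ (-q) := by
      have : J ^ (-q) ≤ R ^ (-q) := Real.rpow_le_rpow_of_nonpos hR0 (by linarith) (by linarith)
      have h4 : 0 < J ^ (-q) := by positivity
      have h5 : 0 < K ^ (-q) := by positivity
      rw [abs_le]; constructor <;> linarith
    have hB : t ^ (-p) ≤ R ^ (-p) := Real.rpow_le_rpow_of_nonpos hR0 h1.le (by linarith)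
    calc |J ^ (-q) - K ^ (-q)| / t ^ p = |J ^ (-q) - K ^ (-q)| * t ^ (-p) := by
          rw [Real.rpow_neg h0.le]; rfl
      _ ≤ (R ^ (-q) + K ^ (-q)) * t ^ (-p) := by gcongr
      _ = 1 * R ^ (-q) * t ^ (-p) + t ^ (-p) * K ^ (-q) := by ring
      _ ≤ (q + 1) * R ^ (-q) * t ^ (-p) + R ^ (-p) * K ^ (-q) := by
          gcongr; linarith
      _ = _ := by rw [← hg]; ring

lemma jap_rpow (a q : ℝ) : (1 + a ^ 2) ^ (-(q / 2)) = √(1 + a ^ 2) ^ (-q) := by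
  rw [Real.sqrt_eq_rpow, ← Real.rpow_mul (by positivity)]; congr 1; ring

/-- Lemma 3 of the paper for `s ∈ (0,1/2)`: with `w(x) = (1+‖x‖²)^(−q₀/2)` and `q₀ > d`,
the integral `∫ (w(x) − w(y))/‖x−y‖^(d+2s) dy` (the fractional Laplacian of `⟨x⟩^(−q₀)`
up to the normalizing constant) is absolutely convergent and bounded in absolute value by
`C ⟨x⟩^(−d−2s)`. -/
theorem stmt5 (d : ℕ) (hd : 1 ≤ d) (s q₀ : ℝ) (hs1 : 0 < s) (hs2 : s < 1 / 2)
    (hq : (d : ℝ) < q₀) :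
    ∃ C > 0, ∀ x : EuclideanSpace ℝ (Fin d),
      Integrable (fun y : EuclideanSpace ℝ (Fin d) =>
        ((1 + ‖x‖ ^ 2) ^ (-(q₀ / 2)) - (1 + ‖y‖ ^ 2) ^ (-(q₀ / 2))) /
          ‖x - y‖ ^ ((d : ℝ) + 2 * s)) ∧
      |∫ y : EuclideanSpace ℝ (Fin d),
          ((1 + ‖x‖ ^ 2) ^ (-(q₀ / 2)) - (1 + ‖y‖ ^ 2) ^ (-(q₀ / 2))) /
            ‖x - y‖ ^ ((d : ℝ) + 2 * s)| ≤
        C * (1 + ‖x‖ ^ 2) ^ (-(((d : ℝ) + 2 * s) / 2)) := by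
  have hd1 : (1 : ℝ) ≤ d := by exact_mod_cast hd
  have hq0 : 0 < q₀ := by linarith
  obtain ⟨p, hp⟩ : ∃ p, p = (d : ℝ) + 2 * s := ⟨_, rfl⟩
  have hp0 : 0 < p := by rw [hp]; positivity
  have hGi := radG_integrable d hd s hs1 hs2
  have hwi : Integrable (fun y : EuclideanSpace ℝ (Fin d) => (1 + ‖y‖ ^ 2) ^ (-(q₀ / 2))) := by
    have := integrable_rpow_neg_one_add_norm_sq (E := EuclideanSpace ℝ (Fin d)) (r := q₀)
      (μ := volume) (by rw [finrank_euclideanSpace_fin]; exact hq)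
    simpa [neg_div] using this
  rw [← hp] at hGi ⊢
  set IG := ∫ z : EuclideanSpace ℝ (Fin d), radG p ‖z‖ with hIG
  set IW := ∫ y : EuclideanSpace ℝ (Fin d), (1 + ‖y‖ ^ 2) ^ (-(q₀ / 2)) with hIW
  have hIG0 : 0 ≤ IG := integral_nonneg fun z => radG_nonneg _ _ (norm_nonneg _)
  have hIW0 : 0 ≤ IW := integral_nonneg fun z => by positivity
  refine ⟨2 ^ p * ((q₀ + 1) * 2 ^ (q₀ - d) * IG + IW + 1), by positivity, fun x => ?_⟩
  obtain ⟨J, hJ⟩ : ∃ J, J = √(1 + ‖x‖ ^ 2) := ⟨_, rfl⟩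
  have hJ1 : 1 ≤ J := by
    rw [hJ]; apply Real.one_le_sqrt.2; nlinarith [sq_nonneg ‖x‖]
  obtain ⟨R, hR⟩ : ∃ R, R = J / 2 := ⟨_, rfl⟩
  have hR0 : 0 < R := by rw [hR]; positivity
  set B : EuclideanSpace ℝ (Fin d) → ℝ := fun y =>
    (q₀ + 1) * R ^ (-q₀) * R ^ (-p) * radG p ‖R⁻¹ • (x - y)‖
        + R ^ (-p) * (1 + ‖y‖ ^ 2) ^ (-(q₀ / 2)) with hB
  have hbound : ∀ y : EuclideanSpace ℝ (Fin d),
      ‖((1 + ‖x‖ ^ 2) ^ (-(q₀ / 2)) - (1 + ‖y‖ ^ 2) ^ (-(q₀ / 2))) / ‖x - y‖ ^ p‖ ≤ B y := by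
    intro y
    have := scalar_bound q₀ p J (√(1 + ‖y‖ ^ 2)) ‖x - y‖ hq0 hp0 (by linarith) (by positivity)
      (norm_nonneg _) (by rw [hJ]; exact (jap_lip _ _).trans (abs_norm_sub_norm_le x y))
    have hn : ‖R⁻¹ • (x - y)‖ = R⁻¹ * ‖x - y‖ := by
      rw [norm_smul, Real.norm_of_nonneg (by positivity)]
    simp only [hB]
    rw [Real.norm_eq_abs, hn, jap_rpow, jap_rpow ‖y‖, ← hJ, hR]
    exact this
  have hGs : Integrable (fun y : EuclideanSpace ℝ (Fin d) => radG p ‖R⁻¹ • (x - y)‖) :=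
    (hGi.comp_smul (inv_ne_zero hR0.ne')).comp_sub_left x
  have hGint : ∫ y : EuclideanSpace ℝ (Fin d), radG p ‖R⁻¹ • (x - y)‖ = R ^ (d : ℝ) * IG := by
    rw [integral_sub_left_eq_self (fun z : EuclideanSpace ℝ (Fin d) => radG p ‖R⁻¹ • z‖) volume x,
      Measure.integral_comp_inv_smul_of_nonneg volume
        (fun z : EuclideanSpace ℝ (Fin d) => radG p ‖z‖) hR0.le,
      finrank_euclideanSpace_fin, smul_eq_mul, Real.rpow_natCast]
  have hBi : Integrable B := (hGs.const_mul _).add (hwi.const_mul _)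
  have hmeas : AEStronglyMeasurable (fun y : EuclideanSpace ℝ (Fin d) =>
        ((1 + ‖x‖ ^ 2) ^ (-(q₀ / 2)) - (1 + ‖y‖ ^ 2) ^ (-(q₀ / 2))) / ‖x - y‖ ^ p) := by
    apply Measurable.aestronglyMeasurable
    fun_prop
  refine ⟨hBi.mono' hmeas (Filter.Eventually.of_forall hbound), ?_⟩
  have h1 := norm_integral_le_of_norm_le hBi (Filter.Eventually.of_forall hbound)
  rw [Real.norm_eq_abs] at h1
  refine h1.trans ?_
  rw [hB, integral_add (hGs.const_mul _) (hwi.const_mul _), integral_const_mul,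
    integral_const_mul, hGint, jap_rpow, ← hJ, ← hIW]
  have hJR : J ^ (-p) * 2 ^ p = R ^ (-p) := by
    rw [hR, Real.div_rpow (by linarith) (by norm_num), Real.rpow_neg (by norm_num : (0:ℝ) ≤ 2),
      div_inv_eq_mul]
  have hRq : R ^ (-q₀) * R ^ (d : ℝ) ≤ 2 ^ (q₀ - d) := by
    rw [← Real.rpow_add hR0]
    have : R ^ (-q₀ + d) ≤ (1 / 2 : ℝ) ^ (-q₀ + d) :=
      Real.rpow_le_rpow_of_nonpos (by norm_num) (by rw [hR]; linarith) (by linarith)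
    refine this.trans (le_of_eq ?_)
    rw [one_div, Real.inv_rpow (by norm_num), ← Real.rpow_neg (by norm_num)]
    congr 1; ring
  calc (q₀ + 1) * R ^ (-q₀) * R ^ (-p) * (R ^ (d : ℝ) * IG) + R ^ (-p) * IW
      = R ^ (-p) * ((q₀ + 1) * (R ^ (-q₀) * R ^ (d : ℝ)) * IG + IW) := by ring
    _ ≤ R ^ (-p) * ((q₀ + 1) * 2 ^ (q₀ - d) * IG + IW + 1) := by
        have : (q₀ + 1) * (R ^ (-q₀) * R ^ (d : ℝ)) * IG ≤ (q₀ + 1) * 2 ^ (q₀ - d) * IG := by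
          gcongr
        exact mul_le_mul_of_nonneg_left (by linarith) (by positivity)
    _ = _ := by rw [← hJR]; ring
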